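/- arXiv:1008.1151 — 4 statements merged into one kernel-verified Lean document; each statement's English description precedes it below -/
import Mathlib

section
/- Let H be a complex separable Hilbert space and {P_i}_{i∈I} a net of non-zero finite-rank orthogonal projections on H. Then the set 𝒮 = { T ∈ B(H) : lim_i ‖T P_i − P_i T‖₂ / ‖P_i‖₂ = 0 } is a unital, norm-closed, *-subalgebra of B(H). Consequently, if {P_i} is a Følner net for a set of operators 𝒯, then {P_i} is a Følner net for the C*-algebra C*(𝒯) generated by 𝒯. -/
open Filter

noncomputable def hsNorm {H : Type*} [NormedAddCommGroup H] [InnerProductSpace ℂ H]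
    {ι : Type*} (e : HilbertBasis ι ℂ H) (A : H →L[ℂ] H) : ℝ :=
  Real.sqrt (∑' i, ‖A (e i)‖ ^ 2)

/-- `P` is a non-zero finite-rank orthogonal projection. -/
def IsFiniteRankProjection {H : Type*} [NormedAddCommGroup H] [InnerProductSpace ℂ H]
    [CompleteSpace H] (P : H →L[ℂ] H) : Prop :=
  IsSelfAdjoint P ∧ P * P = P ∧ P ≠ 0 ∧ FiniteDimensional ℂ (LinearMap.range (P : H →ₗ[ℂ] H))

section HilbertSchmidt

variable {H : Type*} [NormedAddCommGroup H] [InnerProductSpace ℂ H] {ι : Type*}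

/-- The operator `A` has finite Hilbert–Schmidt norm with respect to `e`. -/
def IsHilbertSchmidt (e : HilbertBasis ι ℂ H) (A : H →L[ℂ] H) : Prop :=
  Summable fun i => ‖A (e i)‖ ^ 2

theorem hsNorm_nonneg (e : HilbertBasis ι ℂ H) (A : H →L[ℂ] H) : 0 ≤ hsNorm e A :=
  Real.sqrt_nonneg _

theorem hsNorm_neg (e : HilbertBasis ι ℂ H) (A : H →L[ℂ] H) : hsNorm e (-A) = hsNorm e A := by
  simp [hsNorm]

theorem IsHilbertSchmidt.neg {e : HilbertBasis ι ℂ H} {A : H →L[ℂ] H}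
    (hA : IsHilbertSchmidt e A) : IsHilbertSchmidt e (-A) := by
  simpa [IsHilbertSchmidt] using hA

private theorem isHilbertSchmidt_add_and_hsNorm_add_le {e : HilbertBasis ι ℂ H} {A B : H →L[ℂ] H}
    (hA : IsHilbertSchmidt e A) (hB : IsHilbertSchmidt e B) :
    IsHilbertSchmidt e (A + B) ∧ hsNorm e (A + B) ≤ hsNorm e A + hsNorm e B := by
  have h := Real.Lp_add_le_tsum_of_nonneg (p := 2) (by norm_num)
    (f := fun i => ‖A (e i)‖) (g := fun i => ‖B (e i)‖) (fun _ => norm_nonneg _)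
    (fun _ => norm_nonneg _) (by simpa [IsHilbertSchmidt] using hA)
    (by simpa [IsHilbertSchmidt] using hB)
  simp only [Real.rpow_two, ← Real.sqrt_eq_rpow] at h
  have hle : ∀ i, ‖(A + B) (e i)‖ ^ 2 ≤ (‖A (e i)‖ + ‖B (e i)‖) ^ 2 := fun i => by
    gcongr
    exact norm_add_le _ _
  have hs : IsHilbertSchmidt e (A + B) := Summable.of_nonneg_of_le (fun _ => by positivity) hle h.1
  exact ⟨hs, (Real.sqrt_le_sqrt (hs.tsum_le_tsum hle h.1)).trans h.2⟩

theorem IsHilbertSchmidt.add {e : HilbertBasis ι ℂ H} {A B : H →L[ℂ] H}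
    (hA : IsHilbertSchmidt e A) (hB : IsHilbertSchmidt e B) : IsHilbertSchmidt e (A + B) :=
  (isHilbertSchmidt_add_and_hsNorm_add_le hA hB).1

theorem hsNorm_add_le {e : HilbertBasis ι ℂ H} {A B : H →L[ℂ] H}
    (hA : IsHilbertSchmidt e A) (hB : IsHilbertSchmidt e B) :
    hsNorm e (A + B) ≤ hsNorm e A + hsNorm e B :=
  (isHilbertSchmidt_add_and_hsNorm_add_le hA hB).2

theorem IsHilbertSchmidt.sub {e : HilbertBasis ι ℂ H} {A B : H →L[ℂ] H}
    (hA : IsHilbertSchmidt e A) (hB : IsHilbertSchmidt e B) : IsHilbertSchmidt e (A - B) :=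
  sub_eq_add_neg A B ▸ hA.add hB.neg

theorem hsNorm_sub_le {e : HilbertBasis ι ℂ H} {A B : H →L[ℂ] H}
    (hA : IsHilbertSchmidt e A) (hB : IsHilbertSchmidt e B) :
    hsNorm e (A - B) ≤ hsNorm e A + hsNorm e B := by
  rw [sub_eq_add_neg, ← hsNorm_neg e B]
  exact hsNorm_add_le hA hB.neg

private theorem norm_mul_apply_sq_le (B A : H →L[ℂ] H) (x : H) :
    ‖(B * A) x‖ ^ 2 ≤ ‖B‖ ^ 2 * ‖A x‖ ^ 2 := by
  rw [← mul_pow]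
  gcongr
  exact B.le_opNorm (A x)

theorem IsHilbertSchmidt.mul_left {e : HilbertBasis ι ℂ H} {A : H →L[ℂ] H}
    (hA : IsHilbertSchmidt e A) (B : H →L[ℂ] H) : IsHilbertSchmidt e (B * A) :=
  Summable.of_nonneg_of_le (fun _ => by positivity) (fun i => norm_mul_apply_sq_le B A (e i))
    (Summable.mul_left (‖B‖ ^ 2) hA)

theorem hsNorm_mul_le_left {e : HilbertBasis ι ℂ H} {A : H →L[ℂ] H}
    (hA : IsHilbertSchmidt e A) (B : H →L[ℂ] H) : hsNorm e (B * A) ≤ ‖B‖ * hsNorm e A := by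
  calc hsNorm e (B * A) ≤ Real.sqrt (∑' i, ‖B‖ ^ 2 * ‖A (e i)‖ ^ 2) :=
        Real.sqrt_le_sqrt ((hA.mul_left B).tsum_le_tsum
          (fun i => norm_mul_apply_sq_le B A (e i)) (Summable.mul_left (‖B‖ ^ 2) hA))
    _ = ‖B‖ * hsNorm e A := by
        rw [tsum_mul_left, Real.sqrt_mul (by positivity), Real.sqrt_sq (norm_nonneg _), hsNorm]

theorem HilbertBasis.hasSum_norm_inner_sq (e : HilbertBasis ι ℂ H) (x : H) :
    HasSum (fun i => ‖inner ℂ (e i) x‖ ^ 2) (‖x‖ ^ 2) := by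
  have h := (e.hasSum_inner_mul_inner x x).mapL Complex.reCLM
  convert! h using 1
  · ext i
    rw [← inner_conj_symm x (e i), ← Complex.normSq_eq_conj_mul_self, Complex.reCLM_apply,
      Complex.ofReal_re, Complex.normSq_eq_norm_sq]
  · exact norm_sq_eq_re_inner (𝕜 := ℂ) x

theorem HilbertBasis.tsum_ofReal_norm_inner_sq (e : HilbertBasis ι ℂ H) (x : H) :
    ∑' i, ENNReal.ofReal (‖inner ℂ (e i) x‖ ^ 2) = ENNReal.ofReal (‖x‖ ^ 2) := by
  rw [← (e.hasSum_norm_inner_sq x).tsum_eq, ENNReal.ofReal_tsum_of_nonneg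
    (fun _ => by positivity) (e.hasSum_norm_inner_sq x).summable]

theorem isHilbertSchmidt_iff_tsum_ne_top (e : HilbertBasis ι ℂ H) (A : H →L[ℂ] H) :
    IsHilbertSchmidt e A ↔ ∑' i, ENNReal.ofReal (‖A (e i)‖ ^ 2) ≠ ⊤ := by
  refine ⟨fun h => h.tsum_ofReal_ne_top, fun h => ?_⟩
  have := ENNReal.summable_toReal h
  simpa [IsHilbertSchmidt, ENNReal.toReal_ofReal, sq_nonneg] using this

theorem hsNorm_eq_sqrt_toReal (e : HilbertBasis ι ℂ H) (A : H →L[ℂ] H) :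
    hsNorm e A = Real.sqrt (∑' i, ENNReal.ofReal (‖A (e i)‖ ^ 2)).toReal := by
  rw [ENNReal.tsum_toReal_eq (fun _ => ENNReal.ofReal_ne_top)]
  simp [hsNorm]

variable [CompleteSpace H]

theorem tsum_ofReal_norm_star_apply_sq (e : HilbertBasis ι ℂ H) (A : H →L[ℂ] H) :
    ∑' i, ENNReal.ofReal (‖star A (e i)‖ ^ 2) = ∑' i, ENNReal.ofReal (‖A (e i)‖ ^ 2) := by
  simp_rw [← e.tsum_ofReal_norm_inner_sq]
  rw [ENNReal.tsum_comm]
  congr! 5 with i j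
  rw [ContinuousLinearMap.star_eq_adjoint, ContinuousLinearMap.adjoint_inner_right,
    norm_inner_symm]

theorem hsNorm_star (e : HilbertBasis ι ℂ H) (A : H →L[ℂ] H) : hsNorm e (star A) = hsNorm e A := by
  simp_rw [hsNorm_eq_sqrt_toReal, tsum_ofReal_norm_star_apply_sq]

theorem IsHilbertSchmidt.star {e : HilbertBasis ι ℂ H} {A : H →L[ℂ] H}
    (hA : IsHilbertSchmidt e A) : IsHilbertSchmidt e (star A) := by
  rw [isHilbertSchmidt_iff_tsum_ne_top] at hA ⊢
  rwa [tsum_ofReal_norm_star_apply_sq]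

theorem IsHilbertSchmidt.mul_right {e : HilbertBasis ι ℂ H} {A : H →L[ℂ] H}
    (hA : IsHilbertSchmidt e A) (B : H →L[ℂ] H) : IsHilbertSchmidt e (A * B) := by
  simpa using (hA.star.mul_left (Star.star B)).star

theorem hsNorm_mul_le_right {e : HilbertBasis ι ℂ H} {A : H →L[ℂ] H}
    (hA : IsHilbertSchmidt e A) (B : H →L[ℂ] H) : hsNorm e (A * B) ≤ hsNorm e A * ‖B‖ := by
  have h := hsNorm_mul_le_left hA.star (Star.star B)
  rwa [← star_mul, hsNorm_star, hsNorm_star, norm_star, mul_comm] at h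

theorem IsFiniteRankProjection.isHilbertSchmidt {P : H →L[ℂ] H} (hP : IsFiniteRankProjection P)
    (e : HilbertBasis ι ℂ H) : IsHilbertSchmidt e P := by
  obtain ⟨hsa, hidem, -, hfin⟩ := hP
  let b := stdOrthonormalBasis ℂ (LinearMap.range (P : H →ₗ[ℂ] H))
  have hfix : ∀ y : LinearMap.range (P : H →ₗ[ℂ] H), P y = y := by
    rintro ⟨_, x, rfl⟩
    exact congrArg (fun T : H →L[ℂ] H => T x) hidem
  have key : ∀ x, ‖P x‖ ^ 2 = ∑ k, ‖inner ℂ x (b k : H)‖ ^ 2 := fun x => by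
    have h := b.sum_sq_norm_inner_right ⟨P x, x, rfl⟩
    simp only [Submodule.coe_inner, Submodule.coe_norm] at h
    rw [← h]
    congr! 2 with k
    rw [← ContinuousLinearMap.adjoint_inner_left, hsa.adjoint_eq, hfix, norm_inner_symm]
  simp only [IsHilbertSchmidt, key]
  exact summable_sum fun k _ => (e.hasSum_norm_inner_sq (b k : H)).summable

section Commutator

variable {e : HilbertBasis ι ℂ H} {P : H →L[ℂ] H}

theorem IsHilbertSchmidt.commutator (hP : IsHilbertSchmidt e P) (T : H →L[ℂ] H) :
    IsHilbertSchmidt e (T * P - P * T) :=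
  (hP.mul_left T).sub (hP.mul_right T)

theorem hsNorm_commutator_le (hP : IsHilbertSchmidt e P) (T : H →L[ℂ] H) :
    hsNorm e (T * P - P * T) ≤ 2 * ‖T‖ * hsNorm e P := by
  linarith [hsNorm_sub_le (hP.mul_left T) (hP.mul_right T), hsNorm_mul_le_left hP T,
    hsNorm_mul_le_right hP T]

theorem hsNorm_commutator_add_le (hP : IsHilbertSchmidt e P) (T₁ T₂ : H →L[ℂ] H) :
    hsNorm e ((T₁ + T₂) * P - P * (T₁ + T₂)) ≤
      hsNorm e (T₁ * P - P * T₁) + hsNorm e (T₂ * P - P * T₂) := by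
  rw [show (T₁ + T₂) * P - P * (T₁ + T₂) = (T₁ * P - P * T₁) + (T₂ * P - P * T₂) by noncomm_ring]
  exact hsNorm_add_le (hP.commutator T₁) (hP.commutator T₂)

theorem hsNorm_commutator_mul_le (hP : IsHilbertSchmidt e P) (T₁ T₂ : H →L[ℂ] H) :
    hsNorm e (T₁ * T₂ * P - P * (T₁ * T₂)) ≤
      ‖T₁‖ * hsNorm e (T₂ * P - P * T₂) + hsNorm e (T₁ * P - P * T₁) * ‖T₂‖ := by
  rw [show T₁ * T₂ * P - P * (T₁ * T₂) = T₁ * (T₂ * P - P * T₂) + (T₁ * P - P * T₁) * T₂ by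
    noncomm_ring]
  exact (hsNorm_add_le ((hP.commutator T₂).mul_left T₁) ((hP.commutator T₁).mul_right T₂)).trans
    (add_le_add (hsNorm_mul_le_left (hP.commutator T₂) T₁)
      (hsNorm_mul_le_right (hP.commutator T₁) T₂))

theorem hsNorm_commutator_star (hP : IsSelfAdjoint P) (T : H →L[ℂ] H) :
    hsNorm e (star T * P - P * star T) = hsNorm e (T * P - P * T) := by
  rw [← hsNorm_star e (T * P - P * T), ← hsNorm_neg e (star _), star_sub, star_mul, star_mul,
    hP.star_eq, neg_sub]

end Commutator

end HilbertSchmidt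

section Folner

variable {H : Type*} [NormedAddCommGroup H] [InnerProductSpace ℂ H] [CompleteSpace H]
  {ι I : Type*} {e : HilbertBasis ι ℂ H} {P : I → (H →L[ℂ] H)} {l : Filter I}

/-- The operators that asymptotically commute with the net `P` in normalized Hilbert–Schmidt
norm form a unital star subalgebra. -/
def folnerStarSubalgebra (e : HilbertBasis ι ℂ H) (P : I → (H →L[ℂ] H)) (l : Filter I)
    (hP : ∀ i, IsHilbertSchmidt e (P i)) (hsa : ∀ i, IsSelfAdjoint (P i)) :
    StarSubalgebra ℂ (H →L[ℂ] H) where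
  carrier := {T | Tendsto (fun i => hsNorm e (T * P i - P i * T) / hsNorm e (P i)) l (nhds 0)}
  mul_mem' {T₁ T₂} h₁ h₂ := by
    refine squeeze_zero (fun i => div_nonneg (hsNorm_nonneg _ _) (hsNorm_nonneg _ _))
      (fun i => (div_le_div_of_nonneg_right (hsNorm_commutator_mul_le (hP i) T₁ T₂)
        (hsNorm_nonneg _ _)).trans_eq ?_)
      (by simpa using (h₂.const_mul ‖T₁‖).add (h₁.mul_const ‖T₂‖))
    ring
  add_mem' {T₁ T₂} h₁ h₂ := by
    refine squeeze_zero (fun i => div_nonneg (hsNorm_nonneg _ _) (hsNorm_nonneg _ _))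
      (fun i => (div_le_div_of_nonneg_right (hsNorm_commutator_add_le (hP i) T₁ T₂)
        (hsNorm_nonneg _ _)).trans_eq (add_div _ _ _))
      (by simpa using h₁.add h₂)
  algebraMap_mem' c := by
    simp [Algebra.algebraMap_eq_smul_one, hsNorm, tendsto_const_nhds]
  star_mem' {T} h := by
    simpa only [Set.mem_ofPred_eq, hsNorm_commutator_star (hsa _)] using h

theorem isClosed_folnerStarSubalgebra (hP : ∀ i, IsHilbertSchmidt e (P i))
    (hsa : ∀ i, IsSelfAdjoint (P i)) :
    IsClosed (folnerStarSubalgebra e P l hP hsa : Set (H →L[ℂ] H)) := by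
  rw [← closure_subset_iff_isClosed]
  intro T hT
  refine Metric.tendsto_nhds.2 fun ε hε => ?_
  obtain ⟨T', hT', hd⟩ := Metric.mem_closure_iff.1 hT (ε / 4) (by positivity)
  rw [dist_eq_norm] at hd
  filter_upwards [Metric.tendsto_nhds.1 hT' (ε / 2) (by positivity)] with i hi
  rw [Real.dist_0_eq_abs, abs_of_nonneg (div_nonneg (hsNorm_nonneg _ _) (hsNorm_nonneg _ _))]
    at hi ⊢
  have h := hsNorm_commutator_add_le (hP i) T' (T - T')
  rw [add_sub_cancel] at h
  calc hsNorm e (T * P i - P i * T) / hsNorm e (P i)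
      ≤ (hsNorm e (T' * P i - P i * T') + 2 * ‖T - T'‖ * hsNorm e (P i)) / hsNorm e (P i) :=
        div_le_div_of_nonneg_right (h.trans (by gcongr; exact hsNorm_commutator_le (hP i) _))
          (hsNorm_nonneg _ _)
    _ ≤ hsNorm e (T' * P i - P i * T') / hsNorm e (P i) + 2 * ‖T - T'‖ := by
        rw [add_div]
        gcongr
        exact div_le_of_le_mul₀ (hsNorm_nonneg _ _) (by positivity) le_rfl
    _ < ε := by linarith

end Folner

theorem stmt1 {H : Type*} [NormedAddCommGroup H] [InnerProductSpace ℂ H]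
    [CompleteSpace H] [SecondCountableTopology H]
    {ι : Type*} (e : HilbertBasis ι ℂ H)
    {I : Type*} [Preorder I] [IsDirected I (· ≤ ·)] [Nonempty I]
    (P : I → (H →L[ℂ] H)) (hP : ∀ i, IsFiniteRankProjection (P i))
    (S : Set (H →L[ℂ] H))
    (hS : S = {T | Tendsto (fun i => hsNorm e (T * P i - P i * T) / hsNorm e (P i))
      atTop (nhds 0)}) :
    (1 : H →L[ℂ] H) ∈ S ∧
    (∀ T₁ ∈ S, ∀ T₂ ∈ S, T₁ + T₂ ∈ S) ∧
    (∀ (c : ℂ), ∀ T ∈ S, c • T ∈ S) ∧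
    (∀ T₁ ∈ S, ∀ T₂ ∈ S, T₁ * T₂ ∈ S) ∧
    (∀ T ∈ S, star T ∈ S) ∧
    IsClosed S ∧
    (∀ 𝒯 : Set (H →L[ℂ] H), 𝒯 ⊆ S →
      ((StarAlgebra.adjoin ℂ 𝒯).topologicalClosure : Set (H →L[ℂ] H)) ⊆ S) := by
  have hHS : ∀ i, IsHilbertSchmidt e (P i) := fun i => (hP i).isHilbertSchmidt e
  obtain rfl : S = folnerStarSubalgebra e P atTop hHS fun i => (hP i).1 := hS
  exact ⟨one_mem _, fun _ h₁ _ h₂ => add_mem h₁ h₂, fun c _ h => SMulMemClass.smul_mem c h,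
    fun _ h₁ _ h₂ => mul_mem h₁ h₂, fun _ h => star_mem h, isClosed_folnerStarSubalgebra _ _,
    fun _ h => StarSubalgebra.topologicalClosure_minimal (StarAlgebra.adjoin_le h)
      (isClosed_folnerStarSubalgebra _ _)⟩
end

section
/- Let S₁ be the isometry on H = ℓ²(ℕ₀) defined by S₁ e_i = e_{2i} for the canonical orthonormal basis {e_i : i = 0, 1, 2, …}, and for each n ∈ ℕ₀ let P_n be the orthogonal projection onto span{e_0, e_1, …, e_n}. Then for every n ∈ ℕ one has ‖S₁ P_{2n} − P_{2n} S₁‖₂² = n. -/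
open Filter

/-- The Hilbert space `ℓ²(ℕ₀)`. -/
noncomputable abbrev ell2 : Type := lp (fun _ : ℕ => ℂ) 2

open scoped ENNReal InnerProductSpace in
/-- Parseval's identity in `ℝ≥0∞`. -/
theorem HilbertBasis.tsum_enorm_inner_sq {H ι : Type*} [NormedAddCommGroup H]
    [InnerProductSpace ℂ H] (b : HilbertBasis ι ℂ H) (x : H) :
    ∑' i, ENNReal.ofReal (‖⟪b i, x⟫_ℂ‖ ^ 2) = ENNReal.ofReal (‖x‖ ^ 2) := by
  have h : HasSum (fun i => ‖⟪b i, x⟫_ℂ‖ ^ 2) (‖x‖ ^ 2) := by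
    rw [← Complex.hasSum_ofReal]
    have hsum := b.hasSum_inner_mul_inner x x
    simp only [← inner_conj_symm x (b _), RCLike.conj_mul, inner_self_eq_norm_sq_to_K] at hsum
    exact_mod_cast hsum
  rw [← h.tsum_eq, ENNReal.ofReal_tsum_of_nonneg (fun _ => sq_nonneg _) h.summable]

theorem HilbertBasis.tsum_ofReal_norm_sq_eq_adjoint {H ι κ : Type*} [NormedAddCommGroup H]
    [InnerProductSpace ℂ H] [CompleteSpace H] (b : HilbertBasis ι ℂ H) (c : HilbertBasis κ ℂ H)
    (A : H →L[ℂ] H) :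
    ∑' i, ENNReal.ofReal (‖A (b i)‖ ^ 2) =
      ∑' j, ENNReal.ofReal (‖ContinuousLinearMap.adjoint A (c j)‖ ^ 2) := by
  simp_rw [← c.tsum_enorm_inner_sq (A _), ← b.tsum_enorm_inner_sq (ContinuousLinearMap.adjoint A _)]
  rw [ENNReal.tsum_comm]
  refine tsum_congr fun j => tsum_congr fun i => ?_
  rw [ContinuousLinearMap.adjoint_inner_right, norm_inner_symm]

/-- The Hilbert–Schmidt norm does not depend on the orthonormal basis. -/
theorem hsNorm_eq_hsNorm {H ι κ : Type*} [NormedAddCommGroup H]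
    [InnerProductSpace ℂ H] [CompleteSpace H] (b : HilbertBasis ι ℂ H) (c : HilbertBasis κ ℂ H)
    (A : H →L[ℂ] H) : hsNorm b A = hsNorm c A := by
  have h := congrArg ENNReal.toReal ((b.tsum_ofReal_norm_sq_eq_adjoint c A).trans
    (c.tsum_ofReal_norm_sq_eq_adjoint c A).symm)
  rw [ENNReal.tsum_toReal_eq (fun _ => ENNReal.ofReal_ne_top),
    ENNReal.tsum_toReal_eq (fun _ => ENNReal.ofReal_ne_top)] at h
  simp only [ENNReal.toReal_ofReal (sq_nonneg _)] at h
  rw [hsNorm, hsNorm, h]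

/-- A self-adjoint operator annihilates the vectors orthogonal to its range. -/
theorem IsSelfAdjoint.apply_eq_zero_of_forall_inner_eq_zero {H : Type*} [NormedAddCommGroup H]
    [InnerProductSpace ℂ H] [CompleteSpace H] {P : H →L[ℂ] H} (hP : IsSelfAdjoint P) {x : H}
    (hx : ∀ y, inner ℂ (P y) x = 0) : P x = 0 := by
  refine ext_inner_left ℂ fun y => ?_
  rw [← ContinuousLinearMap.adjoint_inner_left, hP.adjoint_eq, hx, inner_zero_right]

theorem HilbertBasis.projection_apply {H : Type*} [NormedAddCommGroup H]
    [InnerProductSpace ℂ H] [CompleteSpace H] (e : HilbertBasis ℕ ℂ H) {P : H →L[ℂ] H} {m : ℕ}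
    (hP : IsSelfAdjoint P) (hP2 : P * P = P)
    (hrange : LinearMap.range (P : H →ₗ[ℂ] H) = Submodule.span ℂ {x : H | ∃ i ≤ m, x = e i})
    (i : ℕ) : P (e i) = if i ≤ m then e i else 0 := by
  split_ifs with hi
  · have hmem : e i ∈ LinearMap.range (P : H →ₗ[ℂ] H) :=
      hrange ▸ Submodule.subset_span ⟨i, hi, rfl⟩
    obtain ⟨y, hy⟩ := hmem
    rw [← hy]
    exact DFunLike.congr_fun hP2 y
  · refine hP.apply_eq_zero_of_forall_inner_eq_zero fun y => ?_
    have hmem : P y ∈ Submodule.span ℂ {x : H | ∃ i ≤ m, x = e i} :=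
      hrange ▸ LinearMap.mem_range_self (P : H →ₗ[ℂ] H) y
    generalize P y = z at hmem
    induction hmem using Submodule.span_induction with
    | mem x hx =>
      obtain ⟨j, hj, rfl⟩ := hx
      exact e.orthonormal.2 (by omega)
    | zero => exact inner_zero_left _
    | add x z _ _ hx hz => rw [inner_add_left, hx, hz, add_zero]
    | smul a x _ hx => rw [inner_smul_left, hx, mul_zero]

theorem stmt6
    -- the canonical orthonormal basis of `ℓ²(ℕ₀)`
    (e : HilbertBasis ℕ ℂ ell2) (he : ∀ i, (e i : ell2) = lp.single 2 i 1)
    -- an arbitrary orthonormal basis used to compute the Hilbert-Schmidt norm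
    {ι : Type*} (f : HilbertBasis ι ℂ ell2)
    -- the isometry `S₁ e_i = e_{2i}` realizing part of the Cuntz algebra `𝒪₂`
    (S₁ : ell2 →L[ℂ] ell2) (hS₁ : ∀ i, S₁ (e i) = e (2 * i))
    -- `P n` is the orthogonal projection onto `span {e 0, …, e n}`
    (P : ℕ → (ell2 →L[ℂ] ell2))
    (hPsa : ∀ n, IsSelfAdjoint (P n)) (hPidem : ∀ n, P n * P n = P n)
    (hPrange : ∀ n, LinearMap.range ((P n : ell2 →ₗ[ℂ] ell2))
      = Submodule.span ℂ {x : ell2 | ∃ i ≤ n, x = e i}) :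
    ∀ n : ℕ, 1 ≤ n →
      hsNorm f (S₁ * P (2 * n) - P (2 * n) * S₁) ^ 2 = (n : ℝ) := by
  intro n _
  have hP := e.projection_apply (hPsa (2 * n)) (hPidem (2 * n)) (hPrange (2 * n))
  have hterm (i : ℕ) : ‖(S₁ * P (2 * n) - P (2 * n) * S₁) (e i)‖ ^ 2 =
      if i ∈ Finset.Ioc n (2 * n) then (1 : ℝ) else 0 := by
    have happ : (S₁ * P (2 * n) - P (2 * n) * S₁) (e i) =
        S₁ (P (2 * n) (e i)) - P (2 * n) (S₁ (e i)) := rfl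
    simp only [happ, hS₁, hP, Finset.mem_Ioc]
    have hnorm : ‖e (2 * i)‖ = 1 := e.orthonormal.1 _
    rcases le_or_gt i n with h | h
    · rw [if_pos (by omega), if_pos (by omega), if_neg (by omega), hS₁]
      simp
    · rw [if_neg (show ¬2 * i ≤ 2 * n by omega), sub_zero]
      by_cases h2 : i ≤ 2 * n
      · rw [if_pos h2, if_pos ⟨h, h2⟩, hS₁, hnorm, one_pow]
      · rw [if_neg h2, if_neg (fun h' => h2 h'.2)]
        simp
  rw [hsNorm_eq_hsNorm f e, hsNorm, Real.sq_sqrt (tsum_nonneg fun _ => sq_nonneg _)]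
  simp_rw [hterm]
  rw [tsum_eq_sum (s := Finset.Ioc n (2 * n)) fun i hi => if_neg hi,
    Finset.sum_congr rfl fun i hi => if_pos hi]
  simp [two_mul]
end

section
/- Let Γ be a discrete group, F ⊆ Γ a non-empty finite subset, P_F the orthogonal projection of ℓ²(Γ) onto the subspace of functions supported in F, and for γ₀ ∈ Γ let U_{γ₀} be the left-translation unitary on ℓ²(Γ) given by (U_{γ₀} f)(γ) = f(γ₀⁻¹γ). Then ‖U_{γ₀} P_F − P_F U_{γ₀}‖₂² = |(γ₀⁻¹ F) △ F|, where △ denotes the symmetric difference. Consequently, if {Γ_i}_{i∈I} is a Følner net for Γ, then the projections P_i := P_{Γ_i} form a Følner net for the set of unitaries {U_γ : γ ∈ Γ}. -/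
open Filter
open scoped Pointwise symmDiff

/-- Parseval's identity for a coordinate vector of `ℓ²`. -/
theorem HilbertBasis.hasSum_norm_sq_apply {Γ ι : Type*}
    (e : HilbertBasis ι ℂ (lp (fun _ : Γ => ℂ) 2)) (γ : Γ) :
    HasSum (fun i => ‖e i γ‖ ^ 2) 1 := by
  classical
  have h := e.hasSum_inner_mul_inner (lp.single 2 γ (1 : ℂ)) (lp.single 2 γ (1 : ℂ))
  simp only [lp.inner_single_left, lp.inner_single_right] at h
  have hone : inner ℂ ((lp.single 2 γ (1 : ℂ) : lp (fun _ : Γ => ℂ) 2) γ) (1 : ℂ) = 1 := by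
    rw [show (lp.single 2 γ (1 : ℂ) : lp (fun _ : Γ => ℂ) 2) γ = 1 from lp.single_apply_self 2 γ 1]
    simp
  have hterm (i : ι) : inner ℂ (1 : ℂ) (e i γ) * inner ℂ (e i γ) (1 : ℂ)
      = ((‖e i γ‖ ^ 2 : ℝ) : ℂ) := by
    simp [Complex.mul_conj']
  simp only [hterm] at h
  exact Complex.hasSum_ofReal.mp (by simpa only [Complex.ofReal_one] using hone ▸ h)

/-- An operator on `ℓ²` whose `γ`-th output coordinate has, for `γ` in the finite set `S`, the
modulus of the `g γ`-th input coordinate and vanishes otherwise, has squared Hilbert–Schmidt norm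
`S.card`. -/
theorem hsNorm_sq_eq_card {Γ ι : Type*} [DecidableEq Γ]
    (e : HilbertBasis ι ℂ (lp (fun _ : Γ => ℂ) 2))
    (A : lp (fun _ : Γ => ℂ) 2 →L[ℂ] lp (fun _ : Γ => ℂ) 2) (S : Finset Γ) (g : Γ → Γ)
    (hA : ∀ f γ, ‖A f γ‖ = if γ ∈ S then ‖f (g γ)‖ else 0) :
    hsNorm e A ^ 2 = S.card := by
  have hnorm (f : lp (fun _ : Γ => ℂ) 2) : ‖A f‖ ^ 2 = ∑ γ ∈ S, ‖f (g γ)‖ ^ 2 := by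
    have h := lp.norm_rpow_eq_tsum (p := 2) (by norm_num) (A f)
    simp only [ENNReal.toReal_ofNat, Real.rpow_ofNat, hA] at h
    rw [h, tsum_eq_sum (s := S) fun γ hγ => by simp [hγ]]
    exact Finset.sum_congr rfl fun γ hγ => by simp [hγ]
  have hsum : HasSum (fun i => ‖A (e i)‖ ^ 2) (S.card : ℝ) := by
    simp only [hnorm]
    simpa using hasSum_sum fun γ (_ : γ ∈ S) => e.hasSum_norm_sq_apply (g γ)
  rw [hsNorm, hsum.tsum_eq, Real.sq_sqrt (Nat.cast_nonneg _)]

theorem Finset.card_smul_symmDiff_self {Γ : Type*} [Group Γ] [DecidableEq Γ] (g : Γ)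
    (F : Finset Γ) : ((g⁻¹ • F) ∆ F).card = ((g • F) ∆ F).card := by
  rw [← Finset.card_smul_finset g, Finset.smul_finset_symmDiff, smul_inv_smul, symmDiff_comm]

theorem stmt9 {Γ : Type*} [Group Γ] [DecidableEq Γ]
    {ι : Type*} (e : HilbertBasis ι ℂ (lp (fun _ : Γ => ℂ) 2))
    -- the left-translation unitaries `(U γ₀ f) γ = f (γ₀⁻¹ γ)`
    (U : Γ → (lp (fun _ : Γ => ℂ) 2 →L[ℂ] lp (fun _ : Γ => ℂ) 2))
    (hU : ∀ (γ₀ : Γ) (f : lp (fun _ : Γ => ℂ) 2) (γ : Γ), (U γ₀ f) γ = f (γ₀⁻¹ * γ))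
    -- `P F` is the orthogonal projection onto functions supported in `F`
    (P : Finset Γ → (lp (fun _ : Γ => ℂ) 2 →L[ℂ] lp (fun _ : Γ => ℂ) 2))
    (hP : ∀ (F : Finset Γ) (f : lp (fun _ : Γ => ℂ) 2) (γ : Γ),
      (P F f) γ = if γ ∈ F then f γ else 0) :
    (∀ (γ₀ : Γ) (F : Finset Γ), F.Nonempty →
      hsNorm e (U γ₀ * P F - P F * U γ₀) ^ 2 = (((γ₀⁻¹ • F) ∆ F).card : ℝ)) ∧
    (∀ (I : Type*) (_ : Preorder I), IsDirected I (· ≤ ·) → Nonempty I →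
      ∀ Γs : I → Finset Γ, (∀ i, (Γs i).Nonempty) →
      (∀ γ : Γ, Tendsto (fun i => ((((γ • Γs i) ∆ (Γs i)).card : ℝ) / ((Γs i).card : ℝ)))
        atTop (nhds 0)) →
      ∀ γ₀ : Γ, Tendsto
        (fun i => hsNorm e (U γ₀ * P (Γs i) - P (Γs i) * U γ₀) / hsNorm e (P (Γs i)))
        atTop (nhds 0)) := by
  have hcomm (γ₀ : Γ) (F : Finset Γ) :
      hsNorm e (U γ₀ * P F - P F * U γ₀) ^ 2 = (((γ₀⁻¹ • F) ∆ F).card : ℝ) := by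
    rw [Finset.card_smul_symmDiff_self]
    refine hsNorm_sq_eq_card e _ _ (fun γ => γ₀⁻¹ * γ) fun f γ => ?_
    have h : (U γ₀ * P F - P F * U γ₀) f γ
        = (U γ₀ (P F f)) γ - (P F (U γ₀ f)) γ := rfl
    rw [h, hU, hP, hP, hU]
    simp only [Finset.mem_symmDiff, ← Finset.inv_smul_mem_iff, smul_eq_mul]
    by_cases h₁ : γ₀⁻¹ * γ ∈ F <;> by_cases h₂ : γ ∈ F <;> simp [h₁, h₂]
  have hproj (F : Finset Γ) : hsNorm e (P F) ^ 2 = F.card := by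
    refine hsNorm_sq_eq_card e _ _ id fun f γ => ?_
    rw [hP]
    split_ifs <;> simp
  refine ⟨fun γ₀ F _ => hcomm γ₀ F, fun I _ _ _ Γs _ hΓs γ₀ => ?_⟩
  have hlim := (Real.continuous_sqrt.tendsto 0).comp (hΓs γ₀⁻¹)
  rw [Real.sqrt_zero] at hlim
  refine hlim.congr fun i => ?_
  rw [Function.comp_apply, ← hcomm, ← hproj, ← div_pow, Real.sqrt_sq]
  exact div_nonneg (Real.sqrt_nonneg _) (Real.sqrt_nonneg _)
end

section
/- Let 𝕋 be the unit circle with normalized Haar measure, {ε_k(z) = z^k : k ∈ ℤ} the standard orthonormal basis of L²(𝕋), and for n ∈ ℕ₀ let Q_n be the orthogonal projection of L²(𝕋) onto span{ε_0, ε_1, …, ε_n}. Then {Q_n}_{n∈ℕ₀} is a Følner sequence for the algebra of multiplication operators {M_g : g ∈ L^∞(𝕋)} on L²(𝕋): for every g ∈ L^∞(𝕋), lim_{n→∞} ‖M_g Q_n − Q_n M_g‖₂ / ‖Q_n‖₂ = 0. -/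
open Filter MeasureTheory AddCircle
open scoped ENNReal

instance : Fact ((0:ℝ) < 1) := ⟨one_pos⟩

/-- Normalised Haar measure on the circle `𝕋 = ℝ/ℤ`. -/
noncomputable abbrev μT : Measure (AddCircle (1:ℝ)) := haarAddCircle

section HilbertSchmidt

variable {H : Type*} [NormedAddCommGroup H] [InnerProductSpace ℂ H] {ι κ : Type*}

/-- The square of the Hilbert-Schmidt norm of `A`, as an extended nonnegative real. -/
noncomputable def hsSq (e : HilbertBasis ι ℂ H) (A : H →L[ℂ] H) : ℝ≥0∞ :=
  ∑' i, ‖A (e i)‖ₑ ^ 2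

theorem hsNorm_eq_sqrt_toReal_hsSq (e : HilbertBasis ι ℂ H) (A : H →L[ℂ] H) :
    hsNorm e A = Real.sqrt (hsSq e A).toReal := by
  rw [hsNorm, hsSq, ENNReal.tsum_toReal_eq (fun i => by simp)]
  simp

theorem enorm_sq_eq_tsum_inner (f : HilbertBasis κ ℂ H) (x : H) :
    ‖x‖ₑ ^ 2 = ∑' k, ‖inner ℂ (f k) x‖ₑ ^ 2 := by
  have h := lp.hasSum_norm (p := 2) (by norm_num) (f.repr x)
  have h' : HasSum (fun k => ‖inner ℂ (f k) x‖ ^ 2) (‖x‖ ^ 2) := by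
    simpa [f.repr_apply_apply] using h
  have h2 := ENNReal.ofReal_tsum_of_nonneg (fun k => sq_nonneg ‖inner ℂ (f k) x‖) h'.summable
  rw [h'.tsum_eq] at h2
  simpa [ENNReal.ofReal_pow, ofReal_norm] using h2

theorem hsSq_eq_hsSq_adjoint [CompleteSpace H] (e : HilbertBasis ι ℂ H) (f : HilbertBasis κ ℂ H)
    (A : H →L[ℂ] H) : hsSq e A = hsSq f (ContinuousLinearMap.adjoint A) := by
  simp_rw [hsSq, enorm_sq_eq_tsum_inner f (A _),
    enorm_sq_eq_tsum_inner e (ContinuousLinearMap.adjoint A _)]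
  rw [ENNReal.tsum_comm]
  refine tsum_congr fun k => tsum_congr fun i => ?_
  rw [ContinuousLinearMap.adjoint_inner_right, ← inner_conj_symm, RCLike.enorm_conj]

theorem hsSq_eq_hsSq [CompleteSpace H] (e : HilbertBasis ι ℂ H) (f : HilbertBasis κ ℂ H)
    (A : H →L[ℂ] H) : hsSq e A = hsSq f A := by
  rw [hsSq_eq_hsSq_adjoint e f, ← hsSq_eq_hsSq_adjoint f f]

theorem hsSq_sub_le (e : HilbertBasis ι ℂ H) (A B : H →L[ℂ] H) :
    hsSq e (A - B) ≤ 2 * (hsSq e A + hsSq e B) := by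
  rw [hsSq, hsSq, hsSq, ← ENNReal.tsum_add, ← ENNReal.tsum_mul_left]
  refine ENNReal.tsum_le_tsum fun i => ?_
  calc ‖(A - B) (e i)‖ₑ ^ 2 ≤ (‖A (e i)‖ₑ + ‖B (e i)‖ₑ) ^ 2 := by
        gcongr
        exact enorm_sub_le
    _ ≤ 2 * (‖A (e i)‖ₑ ^ 2 + ‖B (e i)‖ₑ ^ 2) := by
        simp only [enorm_eq_nnnorm]
        exact_mod_cast add_sq_le (a := ‖A (e i)‖₊) (b := ‖B (e i)‖₊)

/-- The commutator of `T` with a self-adjoint idempotent `P` is controlled by `(1 - P) T P` and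
`(1 - P) T* P`. -/
theorem hsSq_commutator_le [CompleteSpace H] (e : HilbertBasis ι ℂ H) (T P : H →L[ℂ] H)
    (hsa : IsSelfAdjoint P) :
    hsSq e (T * P - P * T) ≤
      2 * (hsSq e ((1 - P) * T * P) + hsSq e ((1 - P) * star T * P)) := by
  have h1 : T * P - P * T = (1 - P) * T * P - P * T * (1 - P) := by noncomm_ring
  have h2 : star (P * T * (1 - P)) = (1 - P) * star T * P := by
    simp [hsa.star_eq, mul_assoc]
  rw [h1, ← h2, ContinuousLinearMap.star_eq_adjoint, ← hsSq_eq_hsSq_adjoint e e]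
  exact hsSq_sub_le e _ _

variable (f : HilbertBasis ℤ ℂ H) {P : H →L[ℂ] H} {n : ℕ}

theorem hsSq_mul_eq_sum (hP : ∀ k : ℤ, P (f k) = if 0 ≤ k ∧ k ≤ n then f k else 0)
    (A : H →L[ℂ] H) :
    hsSq f (A * P) = ∑ k ∈ Finset.range (n + 1), ‖A (f k)‖ₑ ^ 2 := by
  have hinj : Function.Injective (fun k : ℕ => (k : ℤ)) := Nat.cast_injective
  rw [hsSq, tsum_eq_sum (s := (Finset.range (n + 1)).map ⟨_, hinj⟩), Finset.sum_map]
  · refine Finset.sum_congr rfl fun k hk => ?_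
    have : (0 : ℤ) ≤ k ∧ (k : ℤ) ≤ n := by simp at hk; omega
    simp [hP, this]
  · intro k hk
    have : ¬ (0 ≤ k ∧ k ≤ n) := fun h => hk <| by
      simp only [Finset.mem_map, Finset.mem_range, Function.Embedding.coeFn_mk]
      exact ⟨k.toNat, by omega, by omega⟩
    simp [hP, this]

theorem hsSq_projection (hP : ∀ k : ℤ, P (f k) = if 0 ≤ k ∧ k ≤ n then f k else 0) :
    hsSq f P = n + 1 := by
  have h := hsSq_mul_eq_sum f hP 1
  have h1 : ∀ k, ‖f k‖ₑ = 1 := fun k => by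
    rw [← ofReal_norm, f.orthonormal.1 k, ENNReal.ofReal_one]
  simpa [h1] using h

/-- The tail `∑_{|m| > N} c m`. -/
noncomputable def intTail (c : ℤ → ℝ) (N : ℕ) : ℝ :=
  ∑' m : ℤ, if (N : ℤ) < |m| then c m else 0

theorem tendsto_intTail {c : ℤ → ℝ} (hc : Summable c) : Tendsto (intTail c) atTop (nhds 0) := by
  have h : Tendsto (intTail c) atTop (nhds (∑' _ : ℤ, (0 : ℝ))) := by
    refine tendsto_tsum_of_dominated_convergence hc.norm (fun m => ?_)
      (Eventually.of_forall fun N m => ?_)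
    · refine tendsto_const_nhds.congr' ?_
      filter_upwards [eventually_ge_atTop m.natAbs] with N hN
      rw [if_neg (by rw [Int.abs_eq_natAbs]; omega)]
    · split_ifs <;> simp
  simpa using h

theorem enorm_one_sub_apply_sq_le [CompleteSpace H] (hsa : IsSelfAdjoint P)
    (hP : ∀ k : ℤ, P (f k) = if 0 ≤ k ∧ k ≤ n then f k else 0)
    {T : H →L[ℂ] H} {c : ℤ → ℝ} (hc : Summable c) (hc0 : ∀ m, 0 ≤ c m)
    (hT : ∀ j k, ‖inner ℂ (f j) (T (f k))‖ ^ 2 = c (j - k)) {k : ℕ} (hk : k ≤ n) :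
    ‖((1 - P) * T) (f k)‖ₑ ^ 2 ≤ ENNReal.ofReal (intTail c k + intTail c (n - k)) := by
  have hs : ∀ N : ℕ, Summable fun m : ℤ => if (N : ℤ) < |m| then c m else 0 := fun N =>
    hc.of_nonneg_of_le (fun m => by split_ifs <;> simp [hc0])
      (fun m => by split_ifs <;> simp [hc0])
  have h0 : ∀ (N : ℕ) (m : ℤ), 0 ≤ if (N : ℤ) < |m| then c m else 0 := fun N m => by
    split_ifs <;> simp [hc0]
  rw [intTail, intTail, ← (hs _).tsum_add (hs _),
    ENNReal.ofReal_tsum_of_nonneg (fun m => add_nonneg (h0 _ _) (h0 _ _)) ((hs _).add (hs _)),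
    enorm_sq_eq_tsum_inner f,
    ← (Equiv.subRight (k : ℤ)).tsum_eq (fun m => ENNReal.ofReal _)]
  refine ENNReal.tsum_le_tsum fun j => ?_
  have hin : inner ℂ (f j) (((1 - P) * T) (f k)) =
      if 0 ≤ j ∧ j ≤ n then 0 else inner ℂ (f j) (T (f k)) := by
    have : inner ℂ (f j) (P (T (f k))) = inner ℂ (P (f j)) (T (f k)) := by
      rw [← ContinuousLinearMap.adjoint_inner_left, ← ContinuousLinearMap.star_eq_adjoint,
        hsa.star_eq]
    simp only [mul_apply_eq_comp, sub_apply,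
      one_apply_eq_self, inner_sub_right, this, hP]
    split_ifs <;> simp
  rw [hin, Equiv.subRight_apply]
  by_cases hj : 0 ≤ j ∧ j ≤ n
  · simp [hj]
  · rw [if_neg hj, ← ofReal_norm, ← ENNReal.ofReal_pow (norm_nonneg _), hT]
    refine ENNReal.ofReal_le_ofReal ?_
    rcases lt_or_ge j 0 with h | h
    · rw [if_pos (show (k : ℤ) < |j - k| from lt_abs.2 (by omega))]
      linarith [h0 (n - k) (j - k)]
    · rw [if_pos (show ((n - k : ℕ) : ℤ) < |j - k| from lt_abs.2 (by omega))]
      linarith [h0 k (j - k)]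

theorem intTail_nonneg {c : ℤ → ℝ} (hc0 : ∀ m, 0 ≤ c m) (N : ℕ) : 0 ≤ intTail c N :=
  tsum_nonneg fun m => by split_ifs <;> simp [hc0]

theorem hsSq_off_diagonal_le [CompleteSpace H] (hsa : IsSelfAdjoint P)
    (hP : ∀ k : ℤ, P (f k) = if 0 ≤ k ∧ k ≤ n then f k else 0)
    {T : H →L[ℂ] H} {c : ℤ → ℝ} (hc : Summable c) (hc0 : ∀ m, 0 ≤ c m)
    (hT : ∀ j k, ‖inner ℂ (f j) (T (f k))‖ ^ 2 = c (j - k)) :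
    hsSq f ((1 - P) * T * P) ≤
      ENNReal.ofReal (2 * ∑ k ∈ Finset.range (n + 1), intTail c k) := by
  have hsum : 2 * ∑ k ∈ Finset.range (n + 1), intTail c k =
      ∑ k ∈ Finset.range (n + 1), (intTail c k + intTail c (n - k)) := by
    have := Finset.sum_range_reflect (intTail c) (n + 1)
    simp only [Nat.add_sub_cancel] at this
    rw [Finset.sum_add_distrib, this, two_mul]
  rw [hsSq_mul_eq_sum f hP, hsum, ENNReal.ofReal_sum_of_nonneg
    (fun k _ => add_nonneg (intTail_nonneg hc0 _) (intTail_nonneg hc0 _))]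
  exact Finset.sum_le_sum fun k hk =>
    enorm_one_sub_apply_sq_le f hsa hP hc hc0 hT (Nat.lt_succ_iff.1 (Finset.mem_range.1 hk))

/-- Operators whose matrix entries have moduli depending only on the distance to the diagonal in
a square-summable way admit the spans of `f 0, …, f n` as a Følner sequence. -/
theorem tendsto_hsNorm_commutator_div [CompleteSpace H] (e : HilbertBasis ι ℂ H)
    {P : ℕ → H →L[ℂ] H} (hsa : ∀ n, IsSelfAdjoint (P n))
    (hP : ∀ (n : ℕ) (k : ℤ), P n (f k) = if 0 ≤ k ∧ k ≤ n then f k else 0)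
    {T : H →L[ℂ] H} {c : ℤ → ℝ} (hc : Summable c) (hc0 : ∀ m, 0 ≤ c m)
    (hT : ∀ j k, ‖inner ℂ (f j) (T (f k))‖ ^ 2 = c (j - k)) :
    Tendsto (fun n => hsNorm e (T * P n - P n * T) / hsNorm e (P n)) atTop (nhds 0) := by
  set d : ℤ → ℝ := fun m => c (-m) with hd
  have hdc : Summable d := (Equiv.neg ℤ).summable_iff.2 hc
  have hd0 : ∀ m, 0 ≤ d m := fun m => hc0 _
  have hT' : ∀ j k, ‖inner ℂ (f j) (star T (f k))‖ ^ 2 = d (j - k) := fun j k => by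
    rw [ContinuousLinearMap.star_eq_adjoint, ContinuousLinearMap.adjoint_inner_right,
      norm_inner_symm, hT, hd]
    simp
  set S : ℕ → ℝ := fun n =>
    2 * (2 * ∑ k ∈ Finset.range (n + 1), intTail c k +
      2 * ∑ k ∈ Finset.range (n + 1), intTail d k) with hS
  have hnn : ∀ {c : ℤ → ℝ}, (∀ m, 0 ≤ c m) → ∀ n : ℕ,
      0 ≤ 2 * ∑ k ∈ Finset.range (n + 1), intTail c k := fun hc0 n =>
    mul_nonneg zero_le_two (Finset.sum_nonneg fun k _ => intTail_nonneg hc0 k)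
  have hnum : ∀ n, (hsSq e (T * P n - P n * T)).toReal ≤ S n := fun n => by
    refine ENNReal.toReal_le_of_le_ofReal
      (mul_nonneg zero_le_two (add_nonneg (hnn hc0 n) (hnn hd0 n))) ?_
    rw [hS, ENNReal.ofReal_mul zero_le_two, ENNReal.ofReal_add (hnn hc0 n) (hnn hd0 n),
      hsSq_eq_hsSq e f, ENNReal.ofReal_ofNat]
    refine (hsSq_commutator_le f T (P n) (hsa n)).trans ?_
    gcongr
    · exact hsSq_off_diagonal_le f (hsa n) (hP n) hc hc0 hT
    · exact hsSq_off_diagonal_le f (hsa n) (hP n) hdc hd0 hT'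
  have hden : ∀ n, (hsSq e (P n)).toReal = n + 1 := fun n => by
    rw [hsSq_eq_hsSq e f, hsSq_projection f (hP n)]
    exact_mod_cast ENNReal.toReal_natCast (n + 1)
  have hces : ∀ {c : ℤ → ℝ}, Summable c → Tendsto
      (fun n : ℕ => ((n + 1 : ℕ) : ℝ)⁻¹ * ∑ k ∈ Finset.range (n + 1), intTail c k)
      atTop (nhds 0) := fun hc => (tendsto_intTail hc).cesaro.comp (tendsto_add_atTop_nat 1)
  have hlim : Tendsto (fun n : ℕ => Real.sqrt (S n / (n + 1))) atTop (nhds 0) := by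
    have h := (((hces hc).const_mul 4).add ((hces hdc).const_mul 4)).sqrt
    simp only [mul_zero, add_zero, Real.sqrt_zero] at h
    refine h.congr fun n => ?_
    congr 1
    rw [hS]
    push_cast
    field_simp
    ring
  refine squeeze_zero (fun n => div_nonneg (Real.sqrt_nonneg _) (Real.sqrt_nonneg _))
    (fun n => ?_) hlim
  rw [hsNorm_eq_sqrt_toReal_hsSq, hsNorm_eq_sqrt_toReal_hsSq, ← Real.sqrt_div ENNReal.toReal_nonneg,
    hden]
  gcongr
  exact hnum n

/-- A self-adjoint idempotent with range `span {f 0, …, f n}` acts diagonally on `f`. -/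
theorem projection_apply_basis [CompleteSpace H] (hsa : IsSelfAdjoint P) (hidem : P * P = P)
    (hrange : LinearMap.range (P : H →ₗ[ℂ] H) =
      Submodule.span ℂ {h : H | ∃ k : ℕ, k ≤ n ∧ h = f (k : ℤ)}) (k : ℤ) :
    P (f k) = if 0 ≤ k ∧ k ≤ n then f k else 0 := by
  have hPP : ∀ x, P (P x) = P x := fun x => by
    rw [← mul_apply_eq_comp, hidem]
  split_ifs with hk
  · have hmem : f k ∈ LinearMap.range (P : H →ₗ[ℂ] H) := by
      rw [hrange]
      refine Submodule.subset_span ⟨k.toNat, by omega, ?_⟩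
      rw [Int.toNat_of_nonneg hk.1]
    obtain ⟨x, hx⟩ := hmem
    rw [← hx]
    exact hPP x
  · have hmem : P (f k) ∈ Submodule.span ℂ {h : H | ∃ k : ℕ, k ≤ n ∧ h = f (k : ℤ)} := by
      rw [← hrange]
      exact ⟨f k, rfl⟩
    have hperp : ∀ y ∈ Submodule.span ℂ {h : H | ∃ k : ℕ, k ≤ n ∧ h = f (k : ℤ)},
        inner ℂ (f k) y = 0 := fun y hy => by
      induction hy using Submodule.span_induction with
      | mem y hy =>
        obtain ⟨j, hj, rfl⟩ := hy
        exact f.orthonormal.2 (by omega)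
      | zero => simp
      | add x y _ _ hx hy => rw [inner_add_right, hx, hy, add_zero]
      | smul a x _ hx => rw [inner_smul_right, hx, mul_zero]
    rw [← inner_self_eq_zero (𝕜 := ℂ)]
    have : inner ℂ (P (f k)) (P (f k)) = inner ℂ (f k) (P (P (f k))) := by
      rw [← ContinuousLinearMap.adjoint_inner_right, ← ContinuousLinearMap.star_eq_adjoint,
        hsa.star_eq]
    rw [this, hPP, hperp _ hmem]

end HilbertSchmidt

/-- The matrix of a multiplication operator in the Fourier basis is constant on diagonals. -/
theorem inner_fourierLp_multiplication {A : Lp ℂ 2 μT →L[ℂ] Lp ℂ 2 μT} {g : AddCircle (1:ℝ) → ℂ}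
    (hA : ∀ f : Lp ℂ 2 μT, (A f : AddCircle (1:ℝ) → ℂ) =ᵐ[μT] fun x => g x * f x) (j k : ℤ) :
    inner ℂ (fourierLp 2 j : Lp ℂ 2 μT) (A (fourierLp 2 k)) =
      inner ℂ (fourierLp 2 (j - k) : Lp ℂ 2 μT) (A (fourierLp 2 0)) := by
  rw [L2.inner_def, L2.inner_def]
  refine integral_congr_ae ?_
  filter_upwards [hA (fourierLp 2 k), hA (fourierLp 2 0), coeFn_fourierLp 2 j, coeFn_fourierLp 2 k,
    coeFn_fourierLp 2 (j - k), coeFn_fourierLp 2 0] with x h1 h2 h3 h4 h5 h6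
  rw [h1, h2, h3, h4, h5, h6, sub_eq_add_neg j k]
  simp only [RCLike.inner_apply, fourier_add, fourier_neg, fourier_zero, map_mul,
    RingHomCompTriple.comp_apply, RingHom.id_apply]
  ring

theorem stmt17
    -- an orthonormal basis of `L²(𝕋)` computing Hilbert-Schmidt norms
    {ι : Type*} (e : HilbertBasis ι ℂ (Lp ℂ 2 μT))
    -- multiplication operators by `L^∞` functions
    (M : Lp ℂ ∞ μT → (Lp ℂ 2 μT →L[ℂ] Lp ℂ 2 μT))
    (hM : ∀ (h : Lp ℂ ∞ μT) (f : Lp ℂ 2 μT),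
      (M h f : AddCircle (1:ℝ) → ℂ) =ᵐ[μT]
        fun x => (h : AddCircle (1:ℝ) → ℂ) x * (f : AddCircle (1:ℝ) → ℂ) x)
    -- `Q n` is the orthogonal projection onto `span {ε_0, …, ε_n}`, `ε_k (z) = z^k`
    (Q : ℕ → (Lp ℂ 2 μT →L[ℂ] Lp ℂ 2 μT))
    (hQsa : ∀ n, IsSelfAdjoint (Q n)) (hQidem : ∀ n, Q n * Q n = Q n)
    (hQrange : ∀ n, LinearMap.range ((Q n : Lp ℂ 2 μT →ₗ[ℂ] Lp ℂ 2 μT))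
      = Submodule.span ℂ {h : Lp ℂ 2 μT | ∃ k : ℕ, k ≤ n ∧ h = fourierLp 2 (k : ℤ)})
    -- `{Q n}` is a Følner sequence for the multiplication operators of `L^∞(𝕋)`
    : ∀ g : Lp ℂ ∞ μT,
      Tendsto (fun n => hsNorm e (M g * Q n - Q n * M g) / hsNorm e (Q n)) atTop (nhds 0) := by
  intro g
  have hf : ∀ k : ℤ, (fourierBasis : HilbertBasis ℤ ℂ (Lp ℂ 2 μT)) k = fourierLp 2 k := fun k =>
    congrFun coe_fourierBasis k
  have hsum : Summable fun m : ℤ =>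
      ‖inner ℂ ((fourierBasis : HilbertBasis ℤ ℂ (Lp ℂ 2 μT)) m) (M g (fourierLp 2 0))‖ ^ 2 :=
    fourierBasis.orthonormal.inner_products_summable _
  refine tendsto_hsNorm_commutator_div fourierBasis e hQsa (fun n k => ?_) hsum
    (fun m => sq_nonneg _) (fun j k => ?_)
  · exact projection_apply_basis fourierBasis (hQsa n) (hQidem n) (by simp only [hf, hQrange]) k
  · simp only [hf]
    rw [inner_fourierLp_multiplication (hM g) j k]
end
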